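/- Let (V,g) be an n-dimensional 2-symmetric semi-Riemannian manifold of any signature and let T_{α₁…α_q} be a tensor field with ∇_λ∇_μ T_{α₁…α_q} = 0. Then (∇_ν R^{ρ}_{τλμ} + ∇_τ R^{ρ}_{νλμ}) ∇_ρ T_{α₁…α_q} = 0, i.e. the symmetrized first covariant derivative of the Riemann tensor annihilates ∇T on its first index. -/

import Mathlib

noncomputable section

open scoped BigOperators

/-! ## A local-coordinate framework for semi-Riemannian geometry

A semi-Riemannian manifold is described in a local chart: points are elements of
`Pt n := Fin n → ℝ`, a rank-`q` covariant tensor field is a map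
`Pt n → (Fin q → Fin n) → ℝ`, the metric `g` (with inverse `ginv`) determines the
Christoffel symbols of its Levi-Civita connection, the covariant derivative `covD`,
and the Riemann, Ricci, scalar and Weyl curvatures. -/

/-- Points of a local chart of an `n`-dimensional manifold. -/
abbrev Pt (n : ℕ) : Type := Fin n → ℝ

/-- A rank-`q` (covariant) tensor field, in the chart. -/
abbrev Tensor (n q : ℕ) : Type := Pt n → (Fin q → Fin n) → ℝ

/-- Partial derivative of a scalar field in the `i`-th coordinate direction. -/
def pd {n : ℕ} (i : Fin n) (f : Pt n → ℝ) (x : Pt n) : ℝ :=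
  fderiv ℝ f x (Pi.single i 1)

/-- `g` is a smooth metric of arbitrary signature, with (smooth) inverse `ginv`. -/
def IsMetric {n : ℕ} (g ginv : Pt n → Fin n → Fin n → ℝ) : Prop :=
  (∀ x μ ν, g x μ ν = g x ν μ) ∧
  (∀ μ ν, ContDiff ℝ (⊤ : ℕ∞) fun x => g x μ ν) ∧
  (∀ μ ν, ContDiff ℝ (⊤ : ℕ∞) fun x => ginv x μ ν) ∧
  (∀ x μ ν, (∑ ρ, ginv x μ ρ * g x ρ ν) = if μ = ν then (1 : ℝ) else 0)

/-- The metric `g` has Lorentzian signature `(-,+,…,+)`: at every point there is a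
frame in which it takes the form `diag (-1, 1, …, 1)`. -/
def IsLorentzian {n : ℕ} (g : Pt n → Fin n → Fin n → ℝ) : Prop :=
  ∀ x, ∃ e : Fin n → Fin n → ℝ, ∀ μ ν : Fin n,
    (∑ α, ∑ β, g x α β * e μ α * e ν β) =
      if μ = ν then (if μ.val = 0 then (-1 : ℝ) else 1) else 0

/-- Christoffel symbols `Γ^α_{βγ}` of the Levi-Civita connection of `g`. -/
def christoffel {n : ℕ} (g ginv : Pt n → Fin n → Fin n → ℝ) (x : Pt n) (α β γ : Fin n) : ℝ :=
  (1 / 2) * ∑ ρ, ginv x α ρ *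
    (pd β (fun y => g y ρ γ) x + pd γ (fun y => g y ρ β) x - pd ρ (fun y => g y β γ) x)

/-- Covariant derivative of a rank-`q` covariant tensor field:
`(covD T)_{λ α₁ … α_q} = ∇_λ T_{α₁ … α_q}`; the derivative index comes first. -/
def covD {n q : ℕ} (g ginv : Pt n → Fin n → Fin n → ℝ) (T : Tensor n q) :
    Tensor n (q + 1) := fun x idx =>
  pd (idx 0) (fun y => T y fun i => idx i.succ) x -
    ∑ i : Fin q, ∑ ρ, christoffel g ginv x ρ (idx 0) (idx i.succ) *
      T x (Function.update (fun j => idx j.succ) i ρ)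

/-- Covariant derivative `∇_λ k^μ` of a vector field `k^μ`. -/
def covDVec {n : ℕ} (g ginv : Pt n → Fin n → Fin n → ℝ) (k : Pt n → Fin n → ℝ)
    (x : Pt n) (lam μ : Fin n) : ℝ :=
  pd lam (fun y => k y μ) x + ∑ ρ, christoffel g ginv x μ lam ρ * k x ρ

/-- Riemann curvature tensor `R^α_{βγδ}` of the Levi-Civita connection of `g`. -/
def riemannUp {n : ℕ} (g ginv : Pt n → Fin n → Fin n → ℝ) (x : Pt n) (α β γ δ : Fin n) : ℝ :=
  pd γ (fun y => christoffel g ginv y α δ β) x - pd δ (fun y => christoffel g ginv y α γ β) x +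
    ∑ ρ, (christoffel g ginv x α γ ρ * christoffel g ginv x ρ δ β -
          christoffel g ginv x α δ ρ * christoffel g ginv x ρ γ β)

/-- Fully covariant Riemann tensor `R_{αβγδ} = g_{αρ} R^ρ_{βγδ}`. -/
def riemann {n : ℕ} (g ginv : Pt n → Fin n → Fin n → ℝ) : Tensor n 4 := fun x idx =>
  ∑ ρ, g x (idx 0) ρ * riemannUp g ginv x ρ (idx 1) (idx 2) (idx 3)

/-- Ricci tensor `R_{μν} = R^ρ_{μρν}`. -/
def ricci {n : ℕ} (g ginv : Pt n → Fin n → Fin n → ℝ) : Tensor n 2 := fun x idx =>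
  ∑ ρ, riemannUp g ginv x ρ (idx 0) ρ (idx 1)

/-- Scalar curvature `R = g^{μν} R_{μν}`. -/
def scalarCurv {n : ℕ} (g ginv : Pt n → Fin n → Fin n → ℝ) (x : Pt n) : ℝ :=
  ∑ μ, ∑ ν, ginv x μ ν * ricci g ginv x ![μ, ν]

/-- Weyl conformal tensor `C_{αβλμ}`, defined through the standard decomposition
`R_{αβλμ} = C_{αβλμ} + (2/(n-2)) (R_{α[λ} g_{μ]β} - R_{β[λ} g_{μ]α})
 - (R/((n-1)(n-2))) (g_{αλ} g_{βμ} - g_{αμ} g_{βλ})`. -/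
def weyl {n : ℕ} (g ginv : Pt n → Fin n → Fin n → ℝ) : Tensor n 4 := fun x idx =>
  riemann g ginv x idx -
    (2 / ((n : ℝ) - 2)) *
      ((ricci g ginv x ![idx 0, idx 2] * g x (idx 3) (idx 1) -
        ricci g ginv x ![idx 0, idx 3] * g x (idx 2) (idx 1)) / 2 -
       (ricci g ginv x ![idx 1, idx 2] * g x (idx 3) (idx 0) -
        ricci g ginv x ![idx 1, idx 3] * g x (idx 2) (idx 0)) / 2) +
    (scalarCurv g ginv x / (((n : ℝ) - 1) * ((n : ℝ) - 2))) *
      (g x (idx 0) (idx 2) * g x (idx 1) (idx 3) - g x (idx 0) (idx 3) * g x (idx 1) (idx 2))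

/-- Second-order symmetry (2-symmetry): `∇_μ ∇_ν R_{αβγδ} = 0` everywhere. -/
def TwoSymmetric {n : ℕ} (g ginv : Pt n → Fin n → Fin n → ℝ) : Prop :=
  ∀ x idx, covD g ginv (covD g ginv (riemann g ginv)) x idx = 0

/-- 2-symmetry on a set `D`: `∇_μ ∇_ν R_{αβγδ} = 0` on `D`. -/
def TwoSymmetricOn {n : ℕ} (g ginv : Pt n → Fin n → Fin n → ℝ) (D : Set (Pt n)) : Prop :=
  ∀ x ∈ D, ∀ idx, covD g ginv (covD g ginv (riemann g ginv)) x idx = 0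

/-- Semi-symmetry: `∇_[μ ∇_ν] R_{αβγδ} = 0` everywhere. -/
def SemiSymmetric {n : ℕ} (g ginv : Pt n → Fin n → Fin n → ℝ) : Prop :=
  ∀ x (μ ν α β γ δ : Fin n),
    covD g ginv (covD g ginv (riemann g ginv)) x ![μ, ν, α, β, γ, δ] =
    covD g ginv (covD g ginv (riemann g ginv)) x ![ν, μ, α, β, γ, δ]

/-- `p` is a generic point: the Riemann tensor at `p`, viewed as the endomorphism
`ω_{γδ} ↦ R^{αβ}_{γδ} ω_{γδ}` of the space of 2-forms at `p`, is non-singular. -/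
def GenericAt {n : ℕ} (g ginv : Pt n → Fin n → Fin n → ℝ) (p : Pt n) : Prop :=
  ∀ ω : Fin n → Fin n → ℝ, (∀ γ δ, ω γ δ = -ω δ γ) →
    (∀ α β, (∑ γ, ∑ δ, (∑ σ, ginv p β σ * riemannUp g ginv p α σ γ δ) * ω γ δ) = 0) →
    ω = 0

/-- `k` is a parallel null (nowhere zero) vector field on `D`. -/
def ParallelNullVectorFieldOn {n : ℕ} (g ginv : Pt n → Fin n → Fin n → ℝ)
    (D : Set (Pt n)) (k : Pt n → Fin n → ℝ) : Prop :=
  (∀ x ∈ D, ∀ lam μ, covDVec g ginv k x lam μ = 0) ∧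
  (∀ x ∈ D, (∑ μ, ∑ ν, g x μ ν * k x μ * k x ν) = 0) ∧
  (∀ x ∈ D, k x ≠ 0)

/-- Pullback metric of `g` along a coordinate change `φ`. -/
def pullback {n : ℕ} (g : Pt n → Fin n → Fin n → ℝ) (φ : Pt n → Pt n)
    (x : Pt n) (μ ν : Fin n) : ℝ :=
  ∑ α, ∑ β, g (φ x) α β * pd μ (fun y => φ y α) x * pd ν (fun y => φ y β) x

/-- `k`-th iterated covariant derivative of a rank-`q` tensor field. -/
def covDIter {n : ℕ} (g ginv : Pt n → Fin n → Fin n → ℝ) (q : ℕ) :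
    (k : ℕ) → Tensor n q → Tensor n (q + k)
  | 0, T => T
  | k + 1, T => covD g ginv (covDIter g ginv q k T)

/-- Totally antisymmetric Levi-Civita symbol. -/
def lcSymbol {n : ℕ} (idx : Fin n → Fin n) : ℝ :=
  if h : Function.Bijective idx then ((Equiv.Perm.sign (Equiv.ofBijective idx h) : ℤ) : ℝ) else 0

/-- The metric volume element `n`-form `√|det g| ε_{μ₁…μ_n}`. -/
def volForm {n : ℕ} (g : Pt n → Fin n → Fin n → ℝ) : Tensor n n := fun x idx =>
  Real.sqrt |Matrix.det (Matrix.of (g x))| * lcSymbol idx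

/-- Formal curvature invariants of rank `q`: tensor fields constructed polynomially
from the metric, its inverse, the Riemann tensor, the volume `n`-form, covariant
derivatives, tensor products, (metric) contractions, index permutations, sums and
scalar multiples. -/
inductive TExpr (n : ℕ) : ℕ → Type where
  | metric : TExpr n 2
  | inv : TExpr n 2
  | riem : TExpr n 4
  | eps : TExpr n n
  | cd : {q : ℕ} → TExpr n q → TExpr n (q + 1)
  | tprod : {q r : ℕ} → TExpr n q → TExpr n r → TExpr n (q + r)
  | contr : {q : ℕ} → TExpr n (q + 2) → TExpr n q
  | permute : {q : ℕ} → Equiv.Perm (Fin q) → TExpr n q → TExpr n q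
  | add : {q : ℕ} → TExpr n q → TExpr n q → TExpr n q
  | smul : {q : ℕ} → ℝ → TExpr n q → TExpr n q

/-- Evaluation of a formal curvature invariant as a tensor field. -/
def TExpr.eval {n : ℕ} (g ginv : Pt n → Fin n → Fin n → ℝ) :
    {q : ℕ} → TExpr n q → Tensor n q
  | _, .metric => fun x idx => g x (idx 0) (idx 1)
  | _, .inv => fun x idx => ginv x (idx 0) (idx 1)
  | _, .riem => riemann g ginv
  | _, .eps => volForm g
  | _, .cd e => covD g ginv (TExpr.eval g ginv e)
  | _, .tprod e₁ e₂ => fun x idx =>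
      TExpr.eval g ginv e₁ x (fun i => idx (Fin.castAdd _ i)) *
      TExpr.eval g ginv e₂ x (fun i => idx (Fin.natAdd _ i))
  | _, .contr e => fun x idx =>
      ∑ ρ, ∑ σ, ginv x ρ σ * TExpr.eval g ginv e x (Fin.cons ρ (Fin.cons σ idx))
  | _, .permute π e => fun x idx => TExpr.eval g ginv e x (idx ∘ π)
  | _, .add e₁ e₂ => fun x idx => TExpr.eval g ginv e₁ x idx + TExpr.eval g ginv e₂ x idx
  | _, .smul c e => fun x idx => c * TExpr.eval g ginv e x idx

/-- `e.HasOrderDeg m d`: the invariant `e` is homogeneous of order `m` (number of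
covariant derivatives in each term) and degree `d` (number of Riemann factors in
each term). -/
inductive TExpr.HasOrderDeg {n : ℕ} : {q : ℕ} → TExpr n q → ℕ → ℕ → Prop where
  | metric : HasOrderDeg .metric 0 0
  | inv : HasOrderDeg .inv 0 0
  | riem : HasOrderDeg .riem 0 1
  | eps : HasOrderDeg .eps 0 0
  | cd {q : ℕ} {e : TExpr n q} {m d : ℕ} : HasOrderDeg e m d → HasOrderDeg e.cd (m + 1) d
  | tprod {q r : ℕ} {e₁ : TExpr n q} {e₂ : TExpr n r} {m₁ d₁ m₂ d₂ : ℕ} :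
      HasOrderDeg e₁ m₁ d₁ → HasOrderDeg e₂ m₂ d₂ →
      HasOrderDeg (e₁.tprod e₂) (m₁ + m₂) (d₁ + d₂)
  | contr {q : ℕ} {e : TExpr n (q + 2)} {m d : ℕ} : HasOrderDeg e m d → HasOrderDeg e.contr m d
  | permute {q : ℕ} {π : Equiv.Perm (Fin q)} {e : TExpr n q} {m d : ℕ} :
      HasOrderDeg e m d → HasOrderDeg (e.permute π) m d
  | add {q : ℕ} {e₁ e₂ : TExpr n q} {m d : ℕ} :
      HasOrderDeg e₁ m d → HasOrderDeg e₂ m d → HasOrderDeg (e₁.add e₂) m d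
  | smul {q : ℕ} {c : ℝ} {e : TExpr n q} {m d : ℕ} :
      HasOrderDeg e m d → HasOrderDeg (e.smul c) m d

/-- `P` is the parallel-transport operator along the curve `γ`. -/
def IsTransportAlong {n : ℕ} (g ginv : Pt n → Fin n → Fin n → ℝ)
    (γ : ℝ → Pt n) (P : ℝ → Fin n → Fin n → ℝ) : Prop :=
  (∀ μ ν, P 0 μ ν = if μ = ν then (1 : ℝ) else 0) ∧
  ∀ t μ ν, HasDerivAt (fun s => P s μ ν)
    (-∑ lam, ∑ ρ, christoffel g ginv (γ t) μ lam ρ * deriv (fun s => γ s lam) t * P t ρ ν) t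

/-- The subspace `W` of the tangent space at `p` is invariant under the holonomy
group of `(D, g)` at `p` (parallel transport around smooth loops in `D` based at `p`). -/
def HolonomyInvariantAt {n : ℕ} (g ginv : Pt n → Fin n → Fin n → ℝ) (D : Set (Pt n))
    (p : Pt n) (W : Submodule ℝ (Fin n → ℝ)) : Prop :=
  ∀ γ : ℝ → Pt n, ContDiff ℝ (⊤ : ℕ∞) γ → (∀ t, γ t ∈ D) → γ 0 = p → γ 1 = p →
    ∀ P, IsTransportAlong g ginv γ P →
      ∀ w ∈ W, (fun μ => ∑ ν, P 1 μ ν * w ν) ∈ W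

/-- The holonomy group of `(D,g)` at `p` is reducible: it leaves invariant a
non-trivial subspace of the tangent space. -/
def ReducibleAt {n : ℕ} (g ginv : Pt n → Fin n → Fin n → ℝ) (D : Set (Pt n))
    (p : Pt n) : Prop :=
  ∃ W : Submodule ℝ (Fin n → ℝ), W ≠ ⊥ ∧ W ≠ ⊤ ∧ HolonomyInvariantAt g ginv D p W

/-- The holonomy group of `(D,g)` at `p` is non-degenerately reducible: it leaves
invariant a non-trivial subspace on which `g` is non-degenerate. -/
def NonDegReducibleAt {n : ℕ} (g ginv : Pt n → Fin n → Fin n → ℝ) (D : Set (Pt n))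
    (p : Pt n) : Prop :=
  ∃ W : Submodule ℝ (Fin n → ℝ), W ≠ ⊥ ∧ W ≠ ⊤ ∧ HolonomyInvariantAt g ginv D p W ∧
    ∀ w ∈ W, (∀ u ∈ W, (∑ μ, ∑ ν, g p μ ν * w μ * u ν) = 0) → w = 0

/-! ## Partial derivatives -/

lemma pd_add {n : ℕ} (i : Fin n) {f h : Pt n → ℝ} {x : Pt n}
    (hf : DifferentiableAt ℝ f x) (hh : DifferentiableAt ℝ h x) :
    pd i (fun y => f y + h y) x = pd i f x + pd i h x := by
  simp [pd, fderiv_fun_add hf hh]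

lemma pd_sub {n : ℕ} (i : Fin n) {f h : Pt n → ℝ} {x : Pt n}
    (hf : DifferentiableAt ℝ f x) (hh : DifferentiableAt ℝ h x) :
    pd i (fun y => f y - h y) x = pd i f x - pd i h x := by
  simp [pd, fderiv_fun_sub hf hh]

lemma pd_mul {n : ℕ} (i : Fin n) {f h : Pt n → ℝ} {x : Pt n}
    (hf : DifferentiableAt ℝ f x) (hh : DifferentiableAt ℝ h x) :
    pd i (fun y => f y * h y) x = pd i f x * h x + f x * pd i h x := by
  simp [pd, fderiv_fun_mul hf hh]; ring

lemma pd_sum {n : ℕ} (i : Fin n) {ι : Type*} (s : Finset ι) {f : ι → Pt n → ℝ} {x : Pt n}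
    (hf : ∀ k ∈ s, DifferentiableAt ℝ (f k) x) :
    pd i (fun y => ∑ k ∈ s, f k y) x = ∑ k ∈ s, pd i (f k) x := by
  simp [pd, fderiv_fun_sum hf]

lemma pd_const {n : ℕ} (i : Fin n) (c : ℝ) (x : Pt n) : pd i (fun _ => c) x = 0 := by
  simp [pd]

lemma contDiff_pd {n : ℕ} (i : Fin n) {f : Pt n → ℝ} (hf : ContDiff ℝ (⊤ : ℕ∞) f) :
    ContDiff ℝ (⊤ : ℕ∞) (pd i f) :=
  (hf.fderiv_right (m := (⊤ : ℕ∞)) (by simp)).clm_apply contDiff_const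

lemma pd_comm {n : ℕ} (i j : Fin n) {f : Pt n → ℝ} (hf : ContDiff ℝ (⊤ : ℕ∞) f) (x : Pt n) :
    pd i (pd j f) x = pd j (pd i f) x := by
  have hd : Differentiable ℝ (fderiv ℝ f) :=
    (hf.fderiv_right (m := (⊤ : ℕ∞)) (by simp)).differentiable (by simp)
  have key : ∀ k l : Fin n, pd k (pd l f) x
      = fderiv ℝ (fderiv ℝ f) x (Pi.single k 1) (Pi.single l 1) := by
    intro k l
    change fderiv ℝ (fun y => fderiv ℝ f y (Pi.single l 1)) x (Pi.single k 1) = _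
    rw [fderiv_clm_apply (hd x) (by fun_prop)]
    simp
  rw [key, key]
  have h2 : minSmoothness ℝ 2 ≤ ((⊤ : ℕ∞) : WithTop ℕ∞) := by
    rw [minSmoothness_of_isRCLikeNormedField]
    exact WithTop.coe_le_coe.mpr (le_top : (2 : ℕ∞) ≤ ⊤)
  exact hf.contDiffAt.isSymmSndFDerivAt h2 _ _

/-! ## The derivation action of matrices on covariant tensors -/

/-- The matrix `A^ρ_β` acting as a derivation on covariant tensors:
`(A · t)_{α₁…α_q} = ∑ᵢ A^ρ_{αᵢ} t_{α₁…ρ…α_q}`. -/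
def indexAct {n q : ℕ} : Matrix (Fin n) (Fin n) ℝ →ₗ[ℝ]
    ((Fin q → Fin n) → ℝ) →ₗ[ℝ] ((Fin q → Fin n) → ℝ) :=
  LinearMap.mk₂ ℝ (fun A t α => ∑ i, ∑ ρ, A ρ (α i) * t (Function.update α i ρ))
    (fun A B t => by ext α; simp [add_mul, Finset.sum_add_distrib])
    (fun c A t => by ext α; simp [Finset.mul_sum, mul_assoc])
    (fun A t s => by ext α; simp [mul_add, Finset.sum_add_distrib])
    (fun c A t => by ext α; simp [Finset.mul_sum, mul_left_comm])

lemma indexAct_apply {n q : ℕ} (A : Matrix (Fin n) (Fin n) ℝ) (t : (Fin q → Fin n) → ℝ)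
    (α : Fin q → Fin n) :
    indexAct A t α = ∑ i, ∑ ρ, A ρ (α i) * t (Function.update α i ρ) := rfl

lemma indexAct_cons {n q : ℕ} (A : Matrix (Fin n) (Fin n) ℝ) (t : (Fin (q + 1) → Fin n) → ℝ)
    (μ : Fin n) (α : Fin q → Fin n) :
    indexAct A t (Fin.cons μ α : Fin (q + 1) → Fin n) =
      (∑ ρ, A ρ μ * t (Fin.cons ρ α : Fin (q + 1) → Fin n)) +
        indexAct A (fun β => t (Fin.cons μ β : Fin (q + 1) → Fin n)) α := by
  simp [indexAct_apply, Fin.sum_univ_succ, Fin.cons_update]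

lemma indexAct_vecCons {n q : ℕ} (A : Matrix (Fin n) (Fin n) ℝ)
    (t : (Fin (q + 1) → Fin n) → ℝ) (μ : Fin n) (α : Fin q → Fin n) :
    indexAct A t (Matrix.vecCons μ α) =
      (∑ ρ, A ρ μ * t (Matrix.vecCons ρ α)) +
        indexAct A (fun β => t (Matrix.vecCons μ β)) α :=
  indexAct_cons A t μ α

lemma indexAct_rank_zero {n : ℕ} (A : Matrix (Fin n) (Fin n) ℝ) (t : (Fin 0 → Fin n) → ℝ)
    (α : Fin 0 → Fin n) : indexAct A t α = 0 := by
  simp [indexAct_apply]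

lemma indexAct_commutator {n q : ℕ} (A B : Matrix (Fin n) (Fin n) ℝ)
    (t : (Fin q → Fin n) → ℝ) :
    indexAct A (indexAct B t) - indexAct B (indexAct A t) = indexAct (B * A - A * B) t := by
  have key : ∀ (A B : Matrix (Fin n) (Fin n) ℝ) (α : Fin q → Fin n),
      indexAct A (indexAct B t) α = indexAct (B * A) t α +
        ∑ i, ∑ j, if i = j then 0 else ∑ ρ, ∑ σ, A ρ (α i) * B σ (α j) *
          t (Function.update (Function.update α i ρ) j σ) := by
    intro A B α
    simp only [indexAct_apply]
    rw [← Finset.sum_add_distrib]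
    refine Finset.sum_congr rfl fun i _ => ?_
    simp only [Finset.mul_sum]
    rw [Finset.sum_comm,
      ← Finset.add_sum_erase _ _ (Finset.mem_univ i),
      ← Finset.add_sum_erase (a := i) _ (fun j => if i = j then (0 : ℝ) else _)
        (Finset.mem_univ i)]
    simp only [if_true, zero_add, Function.update_self, Function.update_idem]
    congr 1
    · rw [Finset.sum_comm]
      refine Finset.sum_congr rfl fun σ _ => ?_
      rw [Matrix.mul_apply, Finset.sum_mul]
      exact Finset.sum_congr rfl fun ρ _ => by ring
    · refine Finset.sum_congr rfl fun j hj => ?_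
      have hji : j ≠ i := Finset.ne_of_mem_erase hj
      simp only [if_neg hji.symm, Function.update_of_ne hji, mul_assoc]
  ext α
  rw [Pi.sub_apply, key, key, map_sub, LinearMap.sub_apply, Pi.sub_apply, add_sub_add_comm,
    add_eq_left, sub_eq_zero, Finset.sum_comm]
  refine Finset.sum_congr rfl fun j _ => Finset.sum_congr rfl fun i _ => ?_
  by_cases h : i = j
  · simp [h]
  · rw [if_neg h, if_neg (Ne.symm h), Finset.sum_comm]
    refine Finset.sum_congr rfl fun ρ _ => Finset.sum_congr rfl fun σ _ => ?_
    rw [Function.update_comm h]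
    ring

/-- Entrywise partial derivative of a matrix field. -/
def pdMatrix {n : ℕ} (ν : Fin n) (A : Pt n → Matrix (Fin n) (Fin n) ℝ) (x : Pt n) :
    Matrix (Fin n) (Fin n) ℝ :=
  Matrix.of fun ρ β => pd ν (fun y => A y ρ β) x

lemma pdMatrix_mul {n : ℕ} (ν : Fin n) {A B : Pt n → Matrix (Fin n) (Fin n) ℝ} (x : Pt n)
    (hA : ∀ ρ β, Differentiable ℝ fun y => A y ρ β)
    (hB : ∀ ρ β, Differentiable ℝ fun y => B y ρ β) :
    pdMatrix ν (fun y => A y * B y) x = pdMatrix ν A x * B x + A x * pdMatrix ν B x := by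
  ext ρ β
  simp only [pdMatrix, Matrix.of_apply, Matrix.add_apply, Matrix.mul_apply]
  rw [pd_sum ν _ (f := fun k y => A y ρ k * B y k β) fun k _ => ((hA ρ k).mul (hB k β)) x,
    ← Finset.sum_add_distrib]
  exact Finset.sum_congr rfl fun k _ => pd_mul ν (hA ρ k x) (hB k β x)

lemma differentiable_matrix_mul {n : ℕ} {A B : Pt n → Matrix (Fin n) (Fin n) ℝ}
    (hA : ∀ ρ β, Differentiable ℝ fun y => A y ρ β)
    (hB : ∀ ρ β, Differentiable ℝ fun y => B y ρ β) (ρ β : Fin n) :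
    Differentiable ℝ fun y => (A y * B y) ρ β := by
  simp only [Matrix.mul_apply]
  exact Differentiable.fun_sum fun k _ => (hA ρ k).mul (hB k β)

lemma pd_indexAct {n q : ℕ} (ν : Fin n) {A : Pt n → Matrix (Fin n) (Fin n) ℝ} {t : Tensor n q}
    (x : Pt n) (hA : ∀ ρ β, Differentiable ℝ fun y => A y ρ β)
    (ht : ∀ α, Differentiable ℝ fun y => t y α) (α : Fin q → Fin n) :
    pd ν (fun y => indexAct (A y) (t y) α) x =
      indexAct (pdMatrix ν A x) (t x) α +
        indexAct (A x) (fun β => pd ν (fun y => t y β) x) α := by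
  simp only [indexAct_apply]
  rw [pd_sum ν _ (f := fun i y => ∑ ρ, A y ρ (α i) * t y (Function.update α i ρ))
      fun i _ => Differentiable.fun_sum (fun ρ _ => (hA _ _).mul (ht _)) x,
    ← Finset.sum_add_distrib]
  refine Finset.sum_congr rfl fun i _ => ?_
  rw [pd_sum ν _ (f := fun ρ y => A y ρ (α i) * t y (Function.update α i ρ))
      fun ρ _ => ((hA _ _).mul (ht _)) x, ← Finset.sum_add_distrib]
  exact Finset.sum_congr rfl fun ρ _ => pd_mul ν (hA _ _ x) (ht _ x)

lemma differentiable_indexAct {n q : ℕ} {A : Pt n → Matrix (Fin n) (Fin n) ℝ} {t : Tensor n q}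
    (hA : ∀ ρ β, Differentiable ℝ fun y => A y ρ β)
    (ht : ∀ α, Differentiable ℝ fun y => t y α) (α : Fin q → Fin n) :
    Differentiable ℝ fun y => indexAct (A y) (t y) α := by
  simp only [indexAct_apply]
  exact Differentiable.fun_sum fun i _ => Differentiable.fun_sum fun ρ _ => (hA _ _).mul (ht _)

/-! ## Smoothness of the geometric objects -/

lemma contDiff_christoffel {n : ℕ} {g ginv : Pt n → Fin n → Fin n → ℝ} (hg : IsMetric g ginv)
    (α β γ : Fin n) : ContDiff ℝ (⊤ : ℕ∞) fun x => christoffel g ginv x α β γ := by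
  obtain ⟨-, h1, h2, -⟩ := hg
  unfold christoffel
  exact contDiff_const.mul (ContDiff.sum fun ρ _ => (h2 _ _).mul
    (((contDiff_pd _ (h1 _ _)).add (contDiff_pd _ (h1 _ _))).sub (contDiff_pd _ (h1 _ _))))

lemma contDiff_covD {n q : ℕ} {g ginv : Pt n → Fin n → Fin n → ℝ} (hg : IsMetric g ginv)
    {T : Tensor n q} (hT : ∀ idx, ContDiff ℝ (⊤ : ℕ∞) fun x => T x idx) (idx : Fin (q + 1) → Fin n) :
    ContDiff ℝ (⊤ : ℕ∞) fun x => covD g ginv T x idx := by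
  unfold covD
  exact (contDiff_pd _ (hT _)).sub (ContDiff.sum fun i _ => ContDiff.sum fun ρ _ =>
    (contDiff_christoffel hg _ _ _).mul (hT _))

lemma contDiff_riemann {n : ℕ} {g ginv : Pt n → Fin n → Fin n → ℝ} (hg : IsMetric g ginv)
    (idx : Fin 4 → Fin n) : ContDiff ℝ (⊤ : ℕ∞) fun x => riemann g ginv x idx := by
  have hc := contDiff_christoffel hg
  unfold riemann riemannUp
  exact ContDiff.sum fun ρ _ => (hg.2.1 _ _).mul
    (((contDiff_pd _ (hc _ _ _)).sub (contDiff_pd _ (hc _ _ _))).add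
      (ContDiff.sum fun κ _ => ((hc _ _ _).mul (hc _ _ _)).sub ((hc _ _ _).mul (hc _ _ _))))

/-! ## The connection in matrix form -/

/-- The connection matrix `(Γ_ν)^ρ_β = Γ^ρ_{νβ}`. -/
def connMatrix {n : ℕ} (g ginv : Pt n → Fin n → Fin n → ℝ) (ν : Fin n) (x : Pt n) :
    Matrix (Fin n) (Fin n) ℝ :=
  Matrix.of fun ρ β => christoffel g ginv x ρ ν β

/-- The covariant derivative in the coordinate direction `ν`, treating `ν` as a label. -/
def dirD {n q : ℕ} (g ginv : Pt n → Fin n → Fin n → ℝ) (ν : Fin n) (t : Tensor n q) :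
    Tensor n q := fun x α =>
  pd ν (fun y => t y α) x - indexAct (connMatrix g ginv ν x) (t x) α

/-- The covariant derivative in the direction `ν` of a field of bilinear forms. -/
def bilinD {n : ℕ} (g ginv : Pt n → Fin n → Fin n → ℝ) (ν : Fin n)
    (A : Pt n → Matrix (Fin n) (Fin n) ℝ) (x : Pt n) : Matrix (Fin n) (Fin n) ℝ :=
  pdMatrix ν A x - (connMatrix g ginv ν x).transpose * A x - A x * connMatrix g ginv ν x

/-- The inverse metric as a matrix field. -/
def invMatrix {n : ℕ} (ginv : Pt n → Fin n → Fin n → ℝ) (x : Pt n) :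
    Matrix (Fin n) (Fin n) ℝ := Matrix.of (ginv x)

/-- The curvature matrix `R_{σβλμ}` with `λ, μ` as labels. -/
def curvMatrix {n : ℕ} (g ginv : Pt n → Fin n → Fin n → ℝ) (lam μ : Fin n) (x : Pt n) :
    Matrix (Fin n) (Fin n) ℝ :=
  Matrix.of fun σ β => riemann g ginv x ![σ, β, lam, μ]

/-- The matrix `∇_ν R_{σβλμ}` with `ν, λ, μ` as labels. -/
def covCurvMatrix {n : ℕ} (g ginv : Pt n → Fin n → Fin n → ℝ) (ν lam μ : Fin n) (x : Pt n) :
    Matrix (Fin n) (Fin n) ℝ :=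
  Matrix.of fun σ β => covD g ginv (riemann g ginv) x ![ν, σ, β, lam, μ]

lemma covD_cons {n q : ℕ} (g ginv : Pt n → Fin n → Fin n → ℝ) (T : Tensor n q) (x : Pt n)
    (ν : Fin n) (α : Fin q → Fin n) :
    covD g ginv T x (Fin.cons ν α : Fin (q + 1) → Fin n) = dirD g ginv ν T x α := rfl

lemma covD_vecCons {n q : ℕ} (g ginv : Pt n → Fin n → Fin n → ℝ) (T : Tensor n q) (x : Pt n)
    (ν : Fin n) (α : Fin q → Fin n) :
    covD g ginv T x (Matrix.vecCons ν α) = pd ν (fun y => T y α) x -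
      indexAct (connMatrix g ginv ν x) (T x) α := rfl

lemma dirD_add {n q : ℕ} {g ginv : Pt n → Fin n → Fin n → ℝ} (ν : Fin n) {t s : Tensor n q}
    (x : Pt n) (ht : ∀ α, Differentiable ℝ fun y => t y α)
    (hs : ∀ α, Differentiable ℝ fun y => s y α) :
    dirD g ginv ν (fun y => t y + s y) x = dirD g ginv ν t x + dirD g ginv ν s x := by
  ext α
  simp only [dirD, Pi.add_apply, map_add]
  rw [pd_add ν (ht α x) (hs α x)]
  ring

lemma dirD_cons {n q : ℕ} (g ginv : Pt n → Fin n → Fin n → ℝ) (S : Tensor n (q + 1)) (x : Pt n)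
    (lam μ : Fin n) (α : Fin q → Fin n) :
    dirD g ginv lam S x (Fin.cons μ α : Fin (q + 1) → Fin n) =
      dirD g ginv lam (fun y β => S y (Fin.cons μ β : Fin (q + 1) → Fin n)) x α -
        ∑ ρ, christoffel g ginv x ρ lam μ * S x (Fin.cons ρ α : Fin (q + 1) → Fin n) := by
  simp only [dirD, indexAct_cons, connMatrix, Matrix.of_apply]
  ring

lemma christoffel_symm {n : ℕ} {g ginv : Pt n → Fin n → Fin n → ℝ} (hg : IsMetric g ginv)
    (x : Pt n) (α β γ : Fin n) : christoffel g ginv x α β γ = christoffel g ginv x α γ β := by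
  have h : (fun y => g y β γ) = fun y => g y γ β := funext fun y => hg.1 y β γ
  simp only [christoffel, h]
  congr 1
  exact Finset.sum_congr rfl fun ρ _ => by ring

lemma differentiable_connMatrix {n : ℕ} {g ginv : Pt n → Fin n → Fin n → ℝ}
    (hg : IsMetric g ginv) (ν ρ β : Fin n) :
    Differentiable ℝ fun y => connMatrix g ginv ν y ρ β :=
  (contDiff_christoffel hg ρ ν β).differentiable (by simp)

lemma differentiable_invMatrix {n : ℕ} {g ginv : Pt n → Fin n → Fin n → ℝ}
    (hg : IsMetric g ginv) (ρ β : Fin n) :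
    Differentiable ℝ fun y => invMatrix ginv y ρ β :=
  (hg.2.2.1 ρ β).differentiable (by simp)

lemma differentiable_curvMatrix {n : ℕ} {g ginv : Pt n → Fin n → Fin n → ℝ}
    (hg : IsMetric g ginv) (lam μ ρ β : Fin n) :
    Differentiable ℝ fun y => curvMatrix g ginv lam μ y ρ β :=
  (contDiff_riemann hg _).differentiable (by simp)

lemma differentiable_covCurvMatrix {n : ℕ} {g ginv : Pt n → Fin n → Fin n → ℝ}
    (hg : IsMetric g ginv) (ν lam μ ρ β : Fin n) :
    Differentiable ℝ fun y => covCurvMatrix g ginv ν lam μ y ρ β :=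
  (contDiff_covD hg (contDiff_riemann hg) _).differentiable (by simp)

lemma invMatrix_mul_metric {n : ℕ} {g ginv : Pt n → Fin n → Fin n → ℝ}
    (hg : IsMetric g ginv) (x : Pt n) : invMatrix ginv x * Matrix.of (g x) = 1 := by
  ext μ ν
  simpa [Matrix.mul_apply, Matrix.one_apply, invMatrix] using hg.2.2.2 x μ ν

lemma invMatrix_transpose {n : ℕ} {g ginv : Pt n → Fin n → Fin n → ℝ}
    (hg : IsMetric g ginv) (x : Pt n) : (invMatrix ginv x).transpose = invMatrix ginv x := by
  have h1 := invMatrix_mul_metric hg x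
  have hs : (Matrix.of (g x)).transpose = Matrix.of (g x) := by
    ext i j; exact hg.1 x j i
  have h2 := congrArg Matrix.transpose h1
  rw [Matrix.transpose_mul, hs, Matrix.transpose_one] at h2
  exact (left_inv_eq_right_inv h1 h2).symm

/-- The Levi-Civita connection preserves the inverse metric. -/
lemma pdMatrix_invMatrix {n : ℕ} {g ginv : Pt n → Fin n → Fin n → ℝ}
    (hg : IsMetric g ginv) (ν : Fin n) (x : Pt n) :
    pdMatrix ν (invMatrix ginv) x = -(connMatrix g ginv ν x * invMatrix ginv x) -
      invMatrix ginv x * (connMatrix g ginv ν x).transpose := by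
  set G : Pt n → Matrix (Fin n) (Fin n) ℝ := fun y => Matrix.of (g y) with hG
  set C : Matrix (Fin n) (Fin n) ℝ := Matrix.of fun ρ β => (1 / 2 : ℝ) *
    (pd ν (fun y => g y ρ β) x + pd β (fun y => g y ρ ν) x - pd ρ (fun y => g y ν β) x) with hC
  have hsymm : ∀ i j, (fun y => g y i j) = fun y => g y j i := fun i j =>
    funext fun y => hg.1 y i j
  have hΓ : connMatrix g ginv ν x = invMatrix ginv x * C := by
    ext ρ β
    simp only [connMatrix, invMatrix, hC, Matrix.of_apply, Matrix.mul_apply, christoffel,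
      Finset.mul_sum]
    exact Finset.sum_congr rfl fun κ _ => by ring
  have hCC : C + C.transpose = pdMatrix ν G x := by
    ext ρ β
    simp only [hC, hG, pdMatrix, Matrix.add_apply, Matrix.transpose_apply, Matrix.of_apply]
    rw [hsymm β ρ, hsymm ν β, hsymm ν ρ]
    ring
  have h1 := invMatrix_mul_metric hg x
  have hprod : pdMatrix ν (fun y => invMatrix ginv y * G y) x = 0 := by
    have : (fun y => invMatrix ginv y * G y) = fun _ => 1 :=
      funext fun y => invMatrix_mul_metric hg y
    rw [this]
    ext i j
    simp [pdMatrix, pd_const]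
  rw [pdMatrix_mul (B := G) ν x (differentiable_invMatrix hg)
    fun i j => (hg.2.1 i j).differentiable (by simp)] at hprod
  have h2 : G x * invMatrix ginv x = 1 := mul_eq_one_comm.mp h1
  calc pdMatrix ν (invMatrix ginv) x
      = (pdMatrix ν (invMatrix ginv) x * G x) * invMatrix ginv x := by
        rw [mul_assoc, h2, mul_one]
    _ = -(invMatrix ginv x * (C + C.transpose)) * invMatrix ginv x := by
        rw [hCC, eq_neg_of_add_eq_zero_left hprod]
    _ = _ := by
        rw [hΓ, Matrix.transpose_mul, invMatrix_transpose hg]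
        noncomm_ring

/-- Leibniz rule for the action of `g⁻¹ A`, with `A` a field of bilinear forms. -/
lemma dirD_indexAct {n q : ℕ} {g ginv : Pt n → Fin n → Fin n → ℝ} (hg : IsMetric g ginv)
    (ν : Fin n) {A : Pt n → Matrix (Fin n) (Fin n) ℝ} {t : Tensor n q} (x : Pt n)
    (hA : ∀ ρ β, Differentiable ℝ fun y => A y ρ β)
    (ht : ∀ α, Differentiable ℝ fun y => t y α) :
    dirD g ginv ν (fun y => indexAct (invMatrix ginv y * A y) (t y)) x =
      indexAct (invMatrix ginv x * bilinD g ginv ν A x) (t x) +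
        indexAct (invMatrix ginv x * A x) (dirD g ginv ν t x) := by
  set Γ := connMatrix g ginv ν x with hΓ
  set M := invMatrix ginv x * A x with hM
  have hpd : pdMatrix ν (fun y => invMatrix ginv y * A y) x =
      invMatrix ginv x * bilinD g ginv ν A x - (Γ * M - M * Γ) := by
    rw [pdMatrix_mul ν x (differentiable_invMatrix hg) hA, pdMatrix_invMatrix hg, bilinD]
    simp only [← hΓ, hM]
    noncomm_ring
  have hD : dirD g ginv ν t x =
      (fun β => pd ν (fun y => t y β) x) - indexAct Γ (t x) := rfl
  have hcomm := indexAct_commutator M Γ (t x)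
  ext α
  rw [dirD, pd_indexAct ν x (differentiable_matrix_mul (differentiable_invMatrix hg) hA) ht, hpd,
    hD]
  have hc := congrFun hcomm α
  simp only [map_sub, LinearMap.sub_apply, Pi.sub_apply, Pi.add_apply] at hc ⊢
  linarith

/-- Ricci identity: `∇_λ ∇_μ t - ∇_μ ∇_λ t = -R_{λμ} · t`. -/
lemma covD_covD_sub {n q : ℕ} {g ginv : Pt n → Fin n → Fin n → ℝ} (hg : IsMetric g ginv)
    {t : Tensor n q} (ht : ∀ idx, ContDiff ℝ (⊤ : ℕ∞) fun x => t x idx) (x : Pt n)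
    (lam μ : Fin n) (α : Fin q → Fin n) :
    covD g ginv (covD g ginv t) x
        (Fin.cons lam (Fin.cons μ α : Fin (q + 1) → Fin n) : Fin (q + 2) → Fin n) -
      covD g ginv (covD g ginv t) x
        (Fin.cons μ (Fin.cons lam α : Fin (q + 1) → Fin n) : Fin (q + 2) → Fin n) =
      -indexAct (Matrix.of fun ρ β => riemannUp g ginv x ρ β lam μ) (t x) α := by
  set Γ := connMatrix g ginv with hΓ
  have hR : (Matrix.of fun ρ β => riemannUp g ginv x ρ β lam μ) =
      pdMatrix lam (Γ μ) x - pdMatrix μ (Γ lam) x + (Γ lam x * Γ μ x - Γ μ x * Γ lam x) := by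
    ext ρ β
    simp [riemannUp, hΓ, pdMatrix, connMatrix, Matrix.mul_apply, Finset.sum_sub_distrib]
  have hd : ∀ α, Differentiable ℝ fun y => t y α := fun α => (ht α).differentiable (by simp)
  have hdp : ∀ (κ : Fin n) α, Differentiable ℝ (pd κ fun y => t y α) := fun κ α =>
    (contDiff_pd κ (ht α)).differentiable (by simp)
  have expand : ∀ κ ι : Fin n, dirD g ginv κ (dirD g ginv ι t) x α =
      pd κ (pd ι fun y => t y α) x - indexAct (pdMatrix κ (Γ ι) x) (t x) α
      - indexAct (Γ ι x) (fun β => pd κ (fun y => t y β) x) α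
      - indexAct (Γ κ x) (fun β => pd ι (fun y => t y β) x) α
      + indexAct (Γ κ x) (indexAct (Γ ι x) (t x)) α := by
    intro κ ι
    have hD : dirD g ginv ι t x =
      (fun β => pd ι (fun y => t y β) x) - indexAct (Γ ι x) (t x) := rfl
    rw [dirD, hD]
    have : (fun y => dirD g ginv ι t y α) =
        fun y => pd ι (fun z => t z α) y - indexAct (Γ ι y) (t y) α := rfl
    rw [this, pd_sub κ (hdp ι α x)
      (differentiable_indexAct (differentiable_connMatrix hg ι) hd α x),
      pd_indexAct κ x (differentiable_connMatrix hg ι) hd]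
    simp only [map_sub, Pi.sub_apply]
    ring
  have hc := congrFun (indexAct_commutator (Γ lam x) (Γ μ x) (t x)) α
  have hsum : ∑ ρ, christoffel g ginv x ρ lam μ *
        covD g ginv t x (Fin.cons ρ α : Fin (q + 1) → Fin n) =
      ∑ ρ, christoffel g ginv x ρ μ lam *
        covD g ginv t x (Fin.cons ρ α : Fin (q + 1) → Fin n) :=
    Finset.sum_congr rfl fun ρ _ => by rw [christoffel_symm hg]
  rw [covD_cons, covD_cons, dirD_cons, dirD_cons, hsum, hR]
  simp only [covD_cons]
  have e1 := expand lam μ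
  have e2 := expand μ lam
  rw [pd_comm μ lam (ht α)] at e2
  simp only [map_sub, map_add, LinearMap.sub_apply, LinearMap.add_apply, Pi.sub_apply,
    Pi.add_apply] at hc ⊢
  change dirD g ginv lam (dirD g ginv μ t) x α - _ - (dirD g ginv μ (dirD g ginv lam t) x α - _) = _
  linarith

lemma invMatrix_mul_curvMatrix {n : ℕ} {g ginv : Pt n → Fin n → Fin n → ℝ}
    (hg : IsMetric g ginv) (lam μ : Fin n) (x : Pt n) :
    invMatrix ginv x * curvMatrix g ginv lam μ x =
      Matrix.of fun ρ β => riemannUp g ginv x ρ β lam μ := by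
  have : curvMatrix g ginv lam μ x =
      Matrix.of (g x) * Matrix.of fun ρ β => riemannUp g ginv x ρ β lam μ := by
    ext σ β
    simp [curvMatrix, riemann, Matrix.mul_apply]
  rw [this, ← mul_assoc, invMatrix_mul_metric hg, one_mul]

lemma bilinD_curvMatrix {n : ℕ} (g ginv : Pt n → Fin n → Fin n → ℝ) (ν lam μ : Fin n)
    (x : Pt n) :
    bilinD g ginv ν (curvMatrix g ginv lam μ) x = covCurvMatrix g ginv ν lam μ x +
      ∑ κ, christoffel g ginv x κ ν lam • curvMatrix g ginv κ μ x +
      ∑ κ, christoffel g ginv x κ ν μ • curvMatrix g ginv lam κ x := by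
  ext σ β
  simp only [bilinD, covCurvMatrix, covD_vecCons, indexAct_vecCons, indexAct_rank_zero, pdMatrix,
    curvMatrix, connMatrix, Matrix.of_apply, Matrix.sub_apply, Matrix.add_apply, Matrix.mul_apply,
    Matrix.transpose_apply, Matrix.sum_apply, Matrix.smul_apply, smul_eq_mul]
  simp only [mul_comm (riemann g ginv x _)]
  ring

lemma bilinD_covCurvMatrix {n : ℕ} {g ginv : Pt n → Fin n → Fin n → ℝ}
    (h2 : TwoSymmetric g ginv) (τ ν lam μ : Fin n) (x : Pt n) :
    bilinD g ginv τ (covCurvMatrix g ginv ν lam μ) x =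
      ∑ κ, christoffel g ginv x κ τ ν • covCurvMatrix g ginv κ lam μ x +
      ∑ κ, christoffel g ginv x κ τ lam • covCurvMatrix g ginv ν κ μ x +
      ∑ κ, christoffel g ginv x κ τ μ • covCurvMatrix g ginv ν lam κ x := by
  ext σ β
  have h := h2 x ![τ, ν, σ, β, lam, μ]
  rw [covD_vecCons] at h
  simp only [indexAct_vecCons, indexAct_rank_zero, connMatrix, Matrix.of_apply] at h
  simp only [bilinD, covCurvMatrix, pdMatrix, connMatrix, Matrix.of_apply, Matrix.sub_apply,
    Matrix.add_apply, Matrix.mul_apply, Matrix.transpose_apply, Matrix.sum_apply,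
    Matrix.smul_apply, smul_eq_mul]
  simp only [mul_comm (covD g ginv (riemann g ginv) x _)]
  linarith

/-- If `∇∇t = 0`, the curvature annihilates `t`. -/
lemma indexAct_curvMatrix_eq_zero {n q : ℕ} {g ginv : Pt n → Fin n → Fin n → ℝ}
    (hg : IsMetric g ginv) {t : Tensor n q}
    (ht : ∀ idx, ContDiff ℝ (⊤ : ℕ∞) fun x => t x idx)
    (hpar : ∀ x idx, covD g ginv (covD g ginv t) x idx = 0) (lam μ : Fin n) (x : Pt n) :
    indexAct (invMatrix ginv x * curvMatrix g ginv lam μ x) (t x) = 0 := by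
  ext α
  have h := covD_covD_sub hg ht x lam μ α
  rw [hpar, hpar, ← invMatrix_mul_curvMatrix hg] at h
  simpa using h.symm

/-- The covariant derivative of the identity `R_{λμ} · t = 0`. -/
lemma indexAct_covCurvMatrix_add {n q : ℕ} {g ginv : Pt n → Fin n → Fin n → ℝ}
    (hg : IsMetric g ginv) {t : Tensor n q} (ht : ∀ α, Differentiable ℝ fun y => t y α)
    (h0 : ∀ lam μ x, indexAct (invMatrix ginv x * curvMatrix g ginv lam μ x) (t x) = 0)
    (ν lam μ : Fin n) (x : Pt n) :
    indexAct (invMatrix ginv x * covCurvMatrix g ginv ν lam μ x) (t x) +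
      indexAct (invMatrix ginv x * curvMatrix g ginv lam μ x) (dirD g ginv ν t x) = 0 := by
  have h := dirD_indexAct hg ν x (differentiable_curvMatrix hg lam μ) ht
  have hz : dirD g ginv ν
      (fun y => indexAct (invMatrix ginv y * curvMatrix g ginv lam μ y) (t y)) x = 0 := by
    simp only [h0]
    ext α
    simp [dirD, pd_const]
  rw [hz, bilinD_curvMatrix] at h
  simp only [mul_add, Finset.mul_sum, Matrix.mul_smul, map_add, map_sum, map_smul,
    LinearMap.add_apply, LinearMap.sum_apply, LinearMap.smul_apply, h0, smul_zero,
    Finset.sum_const_zero, add_zero] at h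
  exact h.symm


/-- In an `n`-dimensional 2-symmetric semi-Riemannian manifold of any
signature, if a tensor field `T` satisfies `∇_λ ∇_μ T_{α₁…α_q} = 0`, then
`(∇_ν R^ρ_{τλμ} + ∇_τ R^ρ_{νλμ}) ∇_ρ T_{α₁…α_q} = 0`. -/
theorem stmt3 {n q : ℕ} (g ginv : Pt n → Fin n → Fin n → ℝ) (hg : IsMetric g ginv)
    (h2 : TwoSymmetric g ginv)
    (T : Tensor n q) (hT : ∀ idx, ContDiff ℝ (⊤ : ℕ∞) fun x => T x idx)
    (hTpar : ∀ x idx, covD g ginv (covD g ginv T) x idx = 0) :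
    ∀ (x : Pt n) (ν τ lam μ : Fin n) (α : Fin q → Fin n),
      (∑ ρ, ∑ σ, ginv x ρ σ *
        (covD g ginv (riemann g ginv) x ![ν, σ, τ, lam, μ] +
         covD g ginv (riemann g ginv) x ![τ, σ, ν, lam, μ]) *
        covD g ginv T x (Fin.cons ρ α)) = 0 := by
  set S := covD g ginv T with hS
  have hSd : ∀ α, ContDiff ℝ (⊤ : ℕ∞) fun x => S x α := contDiff_covD hg hT
  have hSpar : ∀ ν x, dirD g ginv ν S x = 0 := fun ν x => funext fun α => hTpar x (Fin.cons ν α)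
  have hSS : ∀ x idx, covD g ginv (covD g ginv S) x idx = 0 := by
    intro x idx
    have h0 : covD g ginv S = fun _ _ => 0 := funext fun y => funext fun α => hTpar y α
    rw [h0]
    simp [covD, pd_const]
  have hTdiff : ∀ α, Differentiable ℝ fun y => T y α := fun α => (hT α).differentiable (by simp)
  have hSdiff : ∀ α, Differentiable ℝ fun y => S y α := fun α => (hSd α).differentiable (by simp)
  have hRT := indexAct_curvMatrix_eq_zero hg hT hTpar
  have hRS := indexAct_curvMatrix_eq_zero hg hSd hSS
  have hA := indexAct_covCurvMatrix_add hg hTdiff hRT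
  have hB : ∀ ν lam μ x,
      indexAct (invMatrix ginv x * covCurvMatrix g ginv ν lam μ x) (S x) = 0 := by
    intro ν lam μ x
    simpa [hSpar] using indexAct_covCurvMatrix_add hg hSdiff hRS ν lam μ x
  intro x ν τ lam μ α
  let s : Fin n → Tensor n q := fun κ y β => S y (Fin.cons κ β : Fin (q + 1) → Fin n)
  have hs : ∀ κ y, dirD g ginv κ T y = s κ y := fun κ y => rfl
  have hsdiff : ∀ κ α, Differentiable ℝ fun y => s κ y α := fun κ α => hSdiff _
  have hds : dirD g ginv τ (s ν) x = ∑ κ, christoffel g ginv x κ τ ν • s κ x := by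
    ext β
    have h := dirD_cons g ginv S x τ ν β
    rw [hSpar] at h
    simp only [Finset.sum_apply, Pi.smul_apply, smul_eq_mul]
    exact sub_eq_zero.mp h.symm
  simp only [hs] at hA
  have hdA : dirD g ginv τ (fun y =>
      indexAct (invMatrix ginv y * covCurvMatrix g ginv ν lam μ y) (T y)) x +
      dirD g ginv τ (fun y =>
        indexAct (invMatrix ginv y * curvMatrix g ginv lam μ y) (s ν y)) x = 0 := by
    rw [← dirD_add τ x
      (differentiable_indexAct (differentiable_matrix_mul (differentiable_invMatrix hg)
        (differentiable_covCurvMatrix hg ν lam μ)) hTdiff)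
      (differentiable_indexAct (differentiable_matrix_mul (differentiable_invMatrix hg)
        (differentiable_curvMatrix hg lam μ)) (hsdiff ν))]
    simp only [hA]
    ext α
    simp [dirD, pd_const]
  rw [dirD_indexAct hg τ x (differentiable_covCurvMatrix hg ν lam μ) hTdiff,
    dirD_indexAct hg τ x (differentiable_curvMatrix hg lam μ) (hsdiff ν),
    bilinD_covCurvMatrix h2, bilinD_curvMatrix, hds, hs] at hdA
  have hcorr : ∀ (c : Fin n → ℝ) (a b d : Fin n → Fin n),
      ∑ κ, c κ • indexAct (invMatrix ginv x * covCurvMatrix g ginv (a κ) (b κ) (d κ) x) (T x) +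
      ∑ κ, c κ • indexAct (invMatrix ginv x * curvMatrix g ginv (b κ) (d κ) x) (s (a κ) x)
        = 0 := by
    intro c a b d
    simp [← Finset.sum_add_distrib, ← smul_add, hA]
  have hsymm : indexAct (invMatrix ginv x * covCurvMatrix g ginv ν lam μ x) (s τ x) +
      indexAct (invMatrix ginv x * covCurvMatrix g ginv τ lam μ x) (s ν x) = 0 := by
    have k1 := hcorr (fun κ => christoffel g ginv x κ τ ν) id (fun _ => lam) fun _ => μ
    have k2 := hcorr (fun κ => christoffel g ginv x κ τ lam) (fun _ => ν) id fun _ => μ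
    have k3 := hcorr (fun κ => christoffel g ginv x κ τ μ) (fun _ => ν) (fun _ => lam) id
    simp only [mul_add, Finset.mul_sum, Matrix.mul_smul, map_add, map_sum, map_smul,
      LinearMap.add_apply, LinearMap.sum_apply, LinearMap.smul_apply, id] at hdA k1 k2 k3
    ext β
    replace hdA := congrFun hdA β
    replace k1 := congrFun k1 β
    replace k2 := congrFun k2 β
    replace k3 := congrFun k3 β
    simp only [Pi.add_apply, Pi.zero_apply] at hdA k1 k2 k3 ⊢
    linarith
  have hsum : ∀ a b : Fin n,
      (∑ ρ, (invMatrix ginv x * covCurvMatrix g ginv a lam μ x) ρ b * s ρ x α) +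
        indexAct (invMatrix ginv x * covCurvMatrix g ginv a lam μ x) (s b x) α = 0 := by
    intro a b
    have h := congrFun (hB a lam μ x) (Fin.cons b α)
    rwa [indexAct_cons] at h
  have hgoal : (∑ ρ, ∑ σ, ginv x ρ σ *
      (covD g ginv (riemann g ginv) x ![ν, σ, τ, lam, μ] +
        covD g ginv (riemann g ginv) x ![τ, σ, ν, lam, μ]) * S x (Fin.cons ρ α)) =
      (∑ ρ, (invMatrix ginv x * covCurvMatrix g ginv ν lam μ x) ρ τ * s ρ x α) +
      ∑ ρ, (invMatrix ginv x * covCurvMatrix g ginv τ lam μ x) ρ ν * s ρ x α := by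
    rw [← Finset.sum_add_distrib]
    refine Finset.sum_congr rfl fun ρ _ => ?_
    simp only [Matrix.mul_apply, Finset.sum_mul, ← Finset.sum_add_distrib]
    exact Finset.sum_congr rfl fun σ _ => by
      simp only [invMatrix, covCurvMatrix, Matrix.of_apply, s]
      ring
  rw [hgoal]
  have h := congrFun hsymm α
  simp only [Pi.add_apply, Pi.zero_apply] at h
  linarith [hsum ν τ, hsum τ ν]
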